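/- Let B and C be r×r matrices over ℝ. Then there exists an invertible r×r matrix R with B·R = C if and only if the rank of the horizontal concatenation [B, C] equals min(rank B, rank C). -/

import Mathlib

/-- Two linear maps with the same range differ by an automorphism of their common
finite-dimensional domain. -/
theorem LinearMap.exists_linearEquiv_comp_eq_of_range_eq {K V W : Type*} [Field K]
    [AddCommGroup V] [Module K V] [FiniteDimensional K V] [AddCommGroup W] [Module K W]
    {f g : V →ₗ[K] W} (h : f.range = g.range) :
    ∃ e : V ≃ₗ[K] V, f ∘ₗ e.toLinearMap = g := by
  obtain ⟨p, hp⟩ := f.ker.exists_isCompl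
  obtain ⟨q, hq⟩ := g.ker.exists_isCompl
  have hker : Module.finrank K g.ker = Module.finrank K f.ker := by
    have hf := f.finrank_range_add_finrank_ker
    have hg := g.finrank_range_add_finrank_ker
    rw [h] at hf
    omega
  let eKer : g.ker ≃ₗ[K] f.ker := LinearEquiv.ofFinrankEq _ _ hker
  let eCompl : q ≃ₗ[K] p := g.kerComplementEquivRange hq.symm ≪≫ₗ
    LinearEquiv.ofEq _ _ h.symm ≪≫ₗ (f.kerComplementEquivRange hp.symm).symm
  have hCompl (y : q) : f (eCompl y) = g y :=
    congrArg Subtype.val ((f.kerComplementEquivRange hp.symm).apply_symm_apply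
      (LinearEquiv.ofEq _ _ h.symm (g.kerComplementEquivRange hq.symm y)))
  refine ⟨(Submodule.prodEquivOfIsCompl _ _ hq).symm ≪≫ₗ eKer.prodCongr eCompl ≪≫ₗ
    Submodule.prodEquivOfIsCompl _ _ hp, LinearMap.ext fun v => ?_⟩
  obtain ⟨⟨x, y⟩, rfl⟩ := (Submodule.prodEquivOfIsCompl _ _ hq).surjective v
  simp [hCompl]

namespace Matrix

theorem range_mulVecLin_fromCols {K m n₁ n₂ : Type*} [CommSemiring K] [Fintype n₁] [Fintype n₂]
    (A : Matrix m n₁ K) (B : Matrix m n₂ K) :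
    (fromCols A B).mulVecLin.range = A.mulVecLin.range ⊔ B.mulVecLin.range := by
  ext v
  simp only [LinearMap.mem_range, Submodule.mem_sup, mulVecLin_apply]
  constructor
  · rintro ⟨w, rfl⟩
    exact ⟨_, ⟨_, rfl⟩, _, ⟨_, rfl⟩, (fromCols_mulVec A B w).symm⟩
  · rintro ⟨_, ⟨x, rfl⟩, _, ⟨y, rfl⟩, rfl⟩
    exact ⟨Sum.elim x y, fromCols_mulVec_sumElim A B x y⟩

theorem exists_isUnit_mul_eq_iff_range_mulVecLin_eq {K m n : Type*} [Field K] [Fintype n]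
    [DecidableEq n] (A B : Matrix m n K) :
    (∃ R : Matrix n n K, IsUnit R ∧ A * R = B) ↔ A.mulVecLin.range = B.mulVecLin.range := by
  constructor
  · rintro ⟨R, hR, rfl⟩
    rw [mulVecLin_mul, LinearMap.range_comp_of_range_eq_top]
    exact LinearMap.range_eq_top.2 (mulVec_surjective_iff_isUnit.2 hR)
  · intro h
    obtain ⟨e, he⟩ := LinearMap.exists_linearEquiv_comp_eq_of_range_eq h
    have hR : (LinearMap.toMatrix' e.toLinearMap).mulVecLin = e.toLinearMap :=
      toLin'_toMatrix' e.toLinearMap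
    refine ⟨LinearMap.toMatrix' e.toLinearMap, mulVec_surjective_iff_isUnit.1 ?_, ?_⟩
    · change Function.Surjective (LinearMap.toMatrix' e.toLinearMap).mulVecLin
      rw [hR]
      exact e.surjective
    · refine toLin'.injective ?_
      rw [toLin'_mul, toLin'_toMatrix']
      exact he

theorem rank_fromCols_eq_min_iff_range_mulVecLin_eq {K m n₁ n₂ : Type*} [Field K] [Finite m]
    [Fintype n₁] [Fintype n₂] (A : Matrix m n₁ K) (B : Matrix m n₂ K) :
    (fromCols A B).rank = min A.rank B.rank ↔ A.mulVecLin.range = B.mulVecLin.range := by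
  rw [rank, rank, rank, range_mulVecLin_fromCols]
  constructor
  · intro h
    exact (Submodule.eq_of_le_of_finrank_le le_sup_left (h.trans_le (min_le_left _ _))).trans
      (Submodule.eq_of_le_of_finrank_le le_sup_right (h.trans_le (min_le_right _ _))).symm
  · intro h
    rw [h, sup_idem, min_self]

end Matrix

/-- Proposition 1 of the paper: there exists an invertible `r × r` real matrix `R` with
`B * R = C` if and only if the rank of the horizontal concatenation `[B, C]` equals
`min (rank B) (rank C)`. -/
theorem exists_invertible_mul_eq_iff_rank_fromColumns_eq_min
    (r : ℕ) (B C : Matrix (Fin r) (Fin r) ℝ) :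
    (∃ R : Matrix (Fin r) (Fin r) ℝ, IsUnit R ∧ B * R = C) ↔
      (Matrix.fromCols B C).rank = min B.rank C.rank :=
  (Matrix.exists_isUnit_mul_eq_iff_range_mulVecLin_eq B C).trans
    (Matrix.rank_fromCols_eq_min_iff_range_mulVecLin_eq B C).symm
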